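/- Let μ ⊢ n, λ ⊨ n, and 1 ≤ l < m. Write μ̃ = (μ_l, μ_{l+1}, …, μ_m) and ñ = μ_l + ⋯ + μ_m. Suppose A_1,…,A_r are row-standard μ-tableaux of type λ which are identical outside rows l, l+1, …, m, and let Ã_1,…,Ã_r be the μ̃-tableaux obtained by deleting rows 1,…,l−1 and rows m+1, m+2,… from each A_i; these have a common type λ̃ ⊨ ñ. If c_1,…,c_r ∈ 𝔽 satisfy ∑_{i=1}^r c_i φ̂_{Ã_i} = 0 (as homomorphisms S^{μ̃} → M^{λ̃} over H_{ñ}), then ∑_{i=1}^r c_i φ̂_{A_i} = 0 (as homomorphisms S^μ → M^λ over H_n). -/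

import Mathlib

open scoped Classical

noncomputable section

namespace FayersSemistd

/-- The value at `q` of the Gaussian (quantum) binomial coefficient polynomial
`[a choose b]`, defined via the `q`-Pascal recurrence. -/
def qBinom {F : Type*} [Field F] (q : F) : ℕ → ℕ → F
  | _, 0 => 1
  | 0, _+1 => 0
  | a+1, b+1 => qBinom q a b + q ^ (b+1) * qBinom q a (b+1)

/-- `∏_i [A_i + B_i choose A_i]_q`, where `A_i`, `B_i` are multiplicities in the
multisets `A` and `B`. -/
def qBinomProd {F : Type*} [Field F] (q : F) (A B : Multiset ℕ) : F :=
  ∏ i ∈ (A + B).toFinset, qBinom q ((A + B).count i) (A.count i)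

/-- `∑_{i<j} A_j * B_i` : the number of pairs `(x,y)` with `x ∈ A`, `y ∈ B`, `y < x`,
counted with multiplicity. -/
def invPairs (A B : Multiset ℕ) : ℕ :=
  ((A.product B).filter (fun p => p.2 < p.1)).card

/-- The Coxeter length of a permutation of `{0,…,n-1}`: its number of inversions. -/
def permLength {n : ℕ} (w : Equiv.Perm (Fin n)) : ℕ :=
  (Finset.univ.filter (fun p : Fin n × Fin n => p.1 < p.2 ∧ w p.2 < w p.1)).card

/-- `λ_0 + ⋯ + λ_{r-1}`. -/
def cumSum (lam : ℕ → ℕ) (r : ℕ) : ℕ := ∑ i ∈ Finset.range r, lam i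

/-- The (0-indexed) row of the diagram of `λ` containing the (0-indexed) position `p`,
when positions are listed row by row. -/
def rowOf (lam : ℕ → ℕ) (p : ℕ) : ℕ := sInf {r | p < cumSum lam (r+1)}

/-- `λ` is a composition of `n`: finitely many nonzero parts, summing to `n`. -/
def IsComposition (n : ℕ) (lam : ℕ → ℕ) : Prop :=
  ∃ N, (∀ r, N ≤ r → lam r = 0) ∧ cumSum lam N = n

/-- `μ` is a partition of `n`. -/
def IsPartition (n : ℕ) (mu : ℕ → ℕ) : Prop := IsComposition n mu ∧ Antitone mu

/-- The conjugate partition (0-indexed): `conjP μ i = #{r | μ r > i}`. -/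
def conjP (mu : ℕ → ℕ) (i : ℕ) : ℕ := sInf {r | mu r ≤ i}

/-- The standard Young subgroup `W_λ` of `S_n` (as a set): the permutations preserving
each consecutive block of sizes `λ_0, λ_1, …`. -/
def youngW {n : ℕ} (lam : ℕ → ℕ) : Set (Equiv.Perm (Fin n)) :=
  {w | ∀ p : Fin n, rowOf lam ((w p : Fin n) : ℕ) = rowOf lam (p : ℕ)}

/-- The adjacent transposition `(i, i+1)` (0-indexed) in `S_n`. -/
def adjT {n : ℕ} (i : ℕ) (h : i + 1 < n) : Equiv.Perm (Fin n) :=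
  Equiv.swap ⟨i, Nat.lt_of_succ_lt h⟩ ⟨i+1, h⟩

/-- `T : S_n → H` is the standard basis of an Iwahori–Hecke algebra of `S_n` over `F`
with parameter `q`.  Permutations act on the right, so the product `w·s` of the paper
is `s * w` in Mathlib's convention; the multiplication rule
`T_w T_s = T_{ws}` (length increasing) resp. `T_w T_s = q T_{ws} + (q-1) T_w`
(length decreasing) determines the algebra structure on the basis. -/
structure IsHeckeBasis {F : Type*} [Field F] {H : Type*} [Ring H] [Algebra F H] {n : ℕ}
    (q : F) (T : Equiv.Perm (Fin n) → H) : Prop where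
  li : LinearIndependent F T
  total : Submodule.span F (Set.range T) = ⊤
  one : T 1 = 1
  mul_adj_asc : ∀ (w : Equiv.Perm (Fin n)) (i : ℕ) (h : i + 1 < n),
    permLength w < permLength (adjT i h * w) →
    T w * T (adjT i h) = T (adjT i h * w)
  mul_adj_desc : ∀ (w : Equiv.Perm (Fin n)) (i : ℕ) (h : i + 1 < n),
    permLength (adjT i h * w) < permLength w →
    T w * T (adjT i h) = q • T (adjT i h * w) + (q - 1) • T w

variable {F : Type*} [Field F] {H : Type*} [Ring H] [Algebra F H] {n : ℕ}

/-- `x_λ = ∑_{w ∈ W_λ} T_w`. -/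
def xElt (T : Equiv.Perm (Fin n) → H) (lam : ℕ → ℕ) : H :=
  ∑ w ∈ Finset.univ.filter (· ∈ youngW lam), T w

/-- `y_λ = ∑_{w ∈ W_λ} (-q)^{-l(w)} T_w`. -/
def yElt (q : F) (T : Equiv.Perm (Fin n) → H) (lam : ℕ → ℕ) : H :=
  ∑ w ∈ Finset.univ.filter (· ∈ youngW lam), ((-q)⁻¹) ^ permLength w • T w

/-- The double coset `W_λ d W_μ` (paper convention: maps act on the right, so the
paper product `u·d·v` is `v * d * u` in Mathlib's convention). -/
def doubleCoset {n : ℕ} (lam mu : ℕ → ℕ) (d : Equiv.Perm (Fin n)) :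
    Set (Equiv.Perm (Fin n)) :=
  {w | ∃ u ∈ youngW (n := n) lam, ∃ v ∈ youngW (n := n) mu, w = v * d * u}

/-- `∑_{w ∈ W_λ 1_A W_μ} T_w`, the image `x_μ φ_A` of `x_μ` under the tableau
homomorphism `φ_A : M^μ → M^λ`, where `d = 1_A`. -/
def XPhi (T : Equiv.Perm (Fin n) → H) (lam mu : ℕ → ℕ) (d : Equiv.Perm (Fin n)) : H :=
  ∑ w ∈ Finset.univ.filter (· ∈ doubleCoset lam mu d), T w

/-- A row-standard tableau is recorded by the multisets of entries of its rows; it has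
shape `μ` when row `r` has `μ_r` entries. -/
def RowsOfShape (mu : ℕ → ℕ) (A : ℕ → Multiset ℕ) : Prop := ∀ r, (A r).card = mu r

/-- The tableau with rows `A 0, A 1, …` has type `λ` when the entry `v` occurs `λ_v`
times in total (entries and types are 0-indexed). -/
def HasType (A : ℕ → Multiset ℕ) (lam : ℕ → ℕ) : Prop :=
  ∀ v, (∑ᶠ r, (A r).count v) = lam v

/-- The entry in row `r`, column `c` (0-indexed) of the row-standard tableau with row
multisets `A`. -/
def entryAt (A : ℕ → Multiset ℕ) (r c : ℕ) : ℕ := ((A r).sort (· ≤ ·)).getD c 0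

/-- `d = 1_A` for the row-standard `μ`-tableau `A` of type `λ`: the tableau `t^λ d`
(whose entry at position `p` is `d p`) is row-standard (first clause), and the entry
`d p` lies in row `r` of `t^λ d` exactly when the position occupied by `d p` in `t^μ`
is occupied by `r` in `A` (second clause). -/
def Is1A {n : ℕ} (mu lam : ℕ → ℕ) (A : ℕ → Multiset ℕ) (d : Equiv.Perm (Fin n)) : Prop :=
  (∀ p p' : Fin n, rowOf lam (p : ℕ) = rowOf lam (p' : ℕ) → p < p' → d p < d p') ∧
  (∀ p : Fin n,
    entryAt A (rowOf mu ((d p : Fin n) : ℕ))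
      (((d p : Fin n) : ℕ) - cumSum mu (rowOf mu ((d p : Fin n) : ℕ)))
      = rowOf lam (p : ℕ))

/-- A row-standard tableau is semistandard if its columns are strictly increasing. -/
def Semistandard (mu : ℕ → ℕ) (A : ℕ → Multiset ℕ) : Prop :=
  ∀ r c, c < mu (r+1) → entryAt A r c < entryAt A (r+1) c

/-- The (0-indexed) column of the position `p` in the diagram of `μ`. -/
def colIdx (mu : ℕ → ℕ) (p : ℕ) : ℕ := p - cumSum mu (rowOf mu p)

/-- `w = w_μ`, i.e. `t^μ w = t_μ`: the image of position `p` is the number of positions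
coming strictly before `p` in the column-reading order of the diagram of `μ`. -/
def IsWmu {n : ℕ} (mu : ℕ → ℕ) (w : Equiv.Perm (Fin n)) : Prop :=
  ∀ p : Fin n, ((w p : Fin n) : ℕ) = (Finset.univ.filter (fun p' : Fin n =>
    colIdx mu (p' : ℕ) < colIdx mu (p : ℕ) ∨
      (colIdx mu (p' : ℕ) = colIdx mu (p : ℕ) ∧ rowOf mu (p' : ℕ) < rowOf mu (p : ℕ)))).card

def comp1 (a : ℕ) : ℕ → ℕ := fun r => if r = 0 then a else 0
def comp2 (a b : ℕ) : ℕ → ℕ := fun r => if r = 0 then a else if r = 1 then b else 0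
def comp3 (a b c : ℕ) : ℕ → ℕ :=
  fun r => if r = 0 then a else if r = 1 then b else if r = 2 then c else 0
def comp4 (a b c d : ℕ) : ℕ → ℕ :=
  fun r => if r = 0 then a else if r = 1 then b else if r = 2 then c else if r = 3 then d else 0
def rows1 (a : Multiset ℕ) : ℕ → Multiset ℕ := fun r => if r = 0 then a else 0
def rows2 (a b : Multiset ℕ) : ℕ → Multiset ℕ :=
  fun r => if r = 0 then a else if r = 1 then b else 0
def rows3 (a b c : Multiset ℕ) : ℕ → Multiset ℕ :=
  fun r => if r = 0 then a else if r = 1 then b else if r = 2 then c else 0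
def rows4 (a b c d : Multiset ℕ) : ℕ → Multiset ℕ :=
  fun r => if r = 0 then a else if r = 1 then b else if r = 2 then c else if r = 3 then d else 0

end FayersSemistd
namespace FayersSemistd

/-- No inversion of `w` is undone by `v`; this says that lengths add in the product `v * w`. -/
def LengthsAdd {n : ℕ} (v w : Equiv.Perm (Fin n)) : Prop :=
  ∀ p p', p < p' → w p' < w p → v (w p') < v (w p)

theorem permLength_mul {n : ℕ} {v w : Equiv.Perm (Fin n)} (h : LengthsAdd v w) :
    permLength (v * w) = permLength v + permLength w := by
  have key : (Finset.univ.filter (fun p : Fin n × Fin n =>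
      p.1 < p.2 ∧ (v * w) p.2 < (v * w) p.1)) =
      (Finset.univ.filter (fun p : Fin n × Fin n => (p.1 < p.2 ∧ (v * w) p.2 < (v * w) p.1) ∧
        w p.1 < w p.2)) ∪
      (Finset.univ.filter (fun p : Fin n × Fin n => p.1 < p.2 ∧ w p.2 < w p.1)) := by
    ext ⟨p, p'⟩
    simp only [Finset.mem_filter, Finset.mem_univ, true_and, Finset.mem_union]
    constructor
    · rintro ⟨h1, h2⟩
      rcases lt_trichotomy (w p) (w p') with h3 | h3 | h3
      · exact Or.inl ⟨⟨h1, h2⟩, h3⟩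
      · exact absurd (w.injective h3) h1.ne
      · exact Or.inr ⟨h1, h3⟩
    · rintro (⟨h1, -⟩ | ⟨h1, h2⟩)
      · exact h1
      · exact ⟨h1, h _ _ h1 h2⟩
  unfold permLength
  rw [key, Finset.card_union_of_disjoint]
  · congr 1
    refine Finset.card_bij (fun p _ => (w p.1, w p.2)) ?_ ?_ ?_
    · rintro ⟨p, p'⟩ hp
      simp only [Finset.mem_filter, Finset.mem_univ, true_and] at hp ⊢
      exact ⟨hp.2, hp.1.2⟩
    · rintro ⟨p, p'⟩ _ ⟨t, t'⟩ _ ht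
      simpa using ht
    · rintro ⟨x, y⟩ hxy
      simp only [Finset.mem_filter, Finset.mem_univ, true_and] at hxy
      refine ⟨(w.symm x, w.symm y), ?_, by simp⟩
      simp only [Finset.mem_filter, Finset.mem_univ, true_and]
      simp only [Equiv.Perm.mul_apply, Equiv.apply_symm_apply]
      refine ⟨⟨?_, hxy.2⟩, hxy.1⟩
      by_contra hlt
      have hne : w.symm y ≠ w.symm x := fun e => hxy.1.ne' (w.symm.injective e)
      have := h _ _ (lt_of_le_of_ne (not_lt.mp hlt) hne) (by simpa using hxy.1)
      simp only [Equiv.apply_symm_apply] at this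
      exact absurd this hxy.2.not_gt
  · rw [Finset.disjoint_left]
    rintro ⟨p, p'⟩ h1 h2
    simp only [Finset.mem_filter, Finset.mem_univ, true_and] at h1 h2
    exact absurd h1.2 h2.2.not_gt

theorem adjT_lt {n : ℕ} {i : ℕ} (hi : i + 1 < n) {x y : Fin n} (hxy : x < y)
    (h : ¬ ((x : ℕ) = i ∧ (y : ℕ) = i + 1)) : adjT i hi x < adjT i hi y := by
  unfold adjT
  rw [Equiv.swap_apply_def, Equiv.swap_apply_def]
  simp only [Fin.lt_def, Fin.ext_iff] at *
  split_ifs <;> simp_all <;> omega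

theorem adjT_mul_adjT {n : ℕ} {i : ℕ} (hi : i + 1 < n) : adjT i hi * adjT i hi = 1 := by
  simp [adjT]

theorem adjT_left {n : ℕ} {i : ℕ} (hi : i + 1 < n) :
    adjT i hi ⟨i, by omega⟩ = ⟨i + 1, hi⟩ := by simp [adjT]

theorem adjT_right {n : ℕ} {i : ℕ} (hi : i + 1 < n) :
    adjT i hi ⟨i + 1, hi⟩ = ⟨i, by omega⟩ := by simp [adjT]

theorem adjT_lengthsAdd {n : ℕ} {i : ℕ} (hi : i + 1 < n) {w : Equiv.Perm (Fin n)}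
    (h : w.symm ⟨i, by omega⟩ < w.symm ⟨i + 1, hi⟩) : LengthsAdd (adjT i hi) w := by
  intro p p' hp hw
  refine adjT_lt hi hw ?_
  rintro ⟨h1, h2⟩
  have e1 : w p' = ⟨i, by omega⟩ := Fin.ext h1
  have e2 : w p = ⟨i + 1, hi⟩ := Fin.ext h2
  rw [← e1, ← e2] at h
  simp only [Equiv.symm_apply_apply] at h
  exact absurd h hp.not_gt

theorem permLength_adjT_pos {n : ℕ} {i : ℕ} (hi : i + 1 < n) : 0 < permLength (adjT i hi) := by
  unfold permLength
  refine Finset.card_pos.mpr ⟨(⟨i, by omega⟩, ⟨i + 1, hi⟩), ?_⟩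
  rw [Finset.mem_filter, adjT_left, adjT_right]
  simp

theorem permLength_lt_adjT_mul {n : ℕ} {i : ℕ} (hi : i + 1 < n) {w : Equiv.Perm (Fin n)}
    (h : w.symm ⟨i, by omega⟩ < w.symm ⟨i + 1, hi⟩) :
    permLength w < permLength (adjT i hi * w) := by
  have := permLength_mul (adjT_lengthsAdd hi h)
  have := permLength_adjT_pos hi
  omega

theorem permLength_ne_adjT_mul {n : ℕ} {i : ℕ} (hi : i + 1 < n) (w : Equiv.Perm (Fin n)) :
    permLength w < permLength (adjT i hi * w) ∨ permLength (adjT i hi * w) < permLength w := by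
  rcases lt_trichotomy (w.symm ⟨i, by omega⟩) (w.symm ⟨i + 1, hi⟩) with h | h | h
  · exact Or.inl (permLength_lt_adjT_mul hi h)
  · simpa using w.symm.injective h
  · right
    have : permLength (adjT i hi * w) < permLength (adjT i hi * (adjT i hi * w)) := by
      apply permLength_lt_adjT_mul
      have e1 : (adjT i hi * w).symm ⟨i, by omega⟩ = w.symm ⟨i + 1, hi⟩ := by
        rw [Equiv.symm_apply_eq, Equiv.Perm.mul_apply, Equiv.apply_symm_apply, adjT_right]
      have e2 : (adjT i hi * w).symm ⟨i + 1, hi⟩ = w.symm ⟨i, by omega⟩ := by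
        rw [Equiv.symm_apply_eq, Equiv.Perm.mul_apply, Equiv.apply_symm_apply, adjT_left]
      rw [e1, e2]
      exact h
    rwa [← mul_assoc, adjT_mul_adjT, one_mul] at this

theorem perm_eq_one_of_strictMono {n : ℕ} {t : Equiv.Perm (Fin n)} (h : StrictMono t) : t = 1 := by
  have h1 : (t : Fin n → Fin n) = id ∘ (1 : Equiv.Perm (Fin n)) := by
    have := Tuple.unique_monotone (f := (id : Fin n → Fin n)) (σ := t) (τ := 1)
      (by simpa using h.monotone) (by intro a b hab; simpa using hab)
    simpa using this
  ext x
  simp [h1]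

/-- Induction on permutations by left multiplication with length-increasing adjacent
transpositions. -/
theorem perm_adjT_induction {n : ℕ} {P : Equiv.Perm (Fin n) → Prop} (one : P 1)
    (step : ∀ (v : Equiv.Perm (Fin n)) (i : ℕ) (hi : i + 1 < n),
      v.symm ⟨i, by omega⟩ < v.symm ⟨i + 1, hi⟩ → P v → P (adjT i hi * v))
    (v : Equiv.Perm (Fin n)) : P v := by
  induction hk : permLength v using Nat.strong_induction_on generalizing v with
  | _ k ih =>
    by_cases hv : ∃ (i : ℕ) (hi : i + 1 < n), v.symm ⟨i + 1, hi⟩ < v.symm ⟨i, by omega⟩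
    · obtain ⟨i, hi, h⟩ := hv
      have e1 : (adjT i hi * v).symm ⟨i, by omega⟩ = v.symm ⟨i + 1, hi⟩ := by
        rw [Equiv.symm_apply_eq, Equiv.Perm.mul_apply, Equiv.apply_symm_apply, adjT_right]
      have e2 : (adjT i hi * v).symm ⟨i + 1, hi⟩ = v.symm ⟨i, by omega⟩ := by
        rw [Equiv.symm_apply_eq, Equiv.Perm.mul_apply, Equiv.apply_symm_apply, adjT_left]
      have h' : (adjT i hi * v).symm ⟨i, by omega⟩ < (adjT i hi * v).symm ⟨i + 1, hi⟩ := by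
        rw [e1, e2]; exact h
      have hl := permLength_lt_adjT_mul hi h'
      have e3 : adjT i hi * (adjT i hi * v) = v := by
        rw [← mul_assoc, adjT_mul_adjT, one_mul]
      rw [e3] at hl
      have := step _ i hi h' (ih _ (hk ▸ hl) _ rfl)
      rwa [e3] at this
    · push Not at hv
      have hmono : StrictMono v.symm := by
        rcases n with _ | n
        · intro a; exact a.elim0
        · refine Fin.strictMono_iff_lt_succ.mpr fun i => ?_
          refine lt_of_le_of_ne (hv i (by omega)) fun e => ?_
          have := v.symm.injective e
          simp [Fin.ext_iff] at this
      have : v⁻¹ = 1 := perm_eq_one_of_strictMono hmono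
      rw [inv_eq_one.mp this]
      exact one

theorem IsHeckeBasis.mul_of_lengthsAdd {F : Type*} [Field F] {H : Type*} [Ring H] [Algebra F H]
    {n : ℕ} {q : F} {T : Equiv.Perm (Fin n) → H}
    (hT : IsHeckeBasis q T) (u v : Equiv.Perm (Fin n)) (h : LengthsAdd v u) :
    T u * T v = T (v * u) := by
  induction v using perm_adjT_induction with
  | one => rw [hT.one, mul_one, one_mul]
  | step v i hi hv ih =>
    have h' : LengthsAdd v u := by
      intro p p' hp hu
      by_contra hc
      have hc' : v (u p) < v (u p') :=
        lt_of_le_of_ne (not_lt.mp hc) fun e => hp.ne (u.injective (v.injective e))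
      have h1 := h p p' hp hu
      simp only [Equiv.Perm.mul_apply] at h1
      by_cases hh : ((v (u p) : Fin n) : ℕ) = i ∧ ((v (u p') : Fin n) : ℕ) = i + 1
      · have a1 : (⟨i, by omega⟩ : Fin n) = v (u p) := Fin.ext hh.1.symm
        have a2 : (⟨i + 1, hi⟩ : Fin n) = v (u p') := Fin.ext hh.2.symm
        rw [a1, a2] at hv
        simp only [Equiv.symm_apply_apply] at hv
        exact absurd hv hu.not_gt
      · exact absurd h1 (adjT_lt hi hc' hh).not_gt
    have hvu : (v * u).symm ⟨i, by omega⟩ < (v * u).symm ⟨i + 1, hi⟩ := by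
      by_contra hc
      have hne : (v * u).symm ⟨i + 1, hi⟩ ≠ (v * u).symm ⟨i, by omega⟩ := by
        intro e; simpa using (v * u).symm.injective e
      have hlt := lt_of_le_of_ne (not_lt.mp hc) hne
      have b1 : v (u ((v * u).symm ⟨i, by omega⟩)) = ⟨i, by omega⟩ :=
        (v * u).apply_symm_apply _
      have b2 : v (u ((v * u).symm ⟨i + 1, hi⟩)) = ⟨i + 1, hi⟩ :=
        (v * u).apply_symm_apply _
      have b3 : u ((v * u).symm ⟨i, by omega⟩) < u ((v * u).symm ⟨i + 1, hi⟩) := by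
        rwa [← v.symm_apply_eq.mpr b1.symm, ← v.symm_apply_eq.mpr b2.symm]
      have := h _ _ hlt b3
      simp only [Equiv.Perm.mul_apply, b1, b2, adjT_left, adjT_right] at this
      simp [Fin.lt_def] at this
    rw [← hT.mul_adj_asc v i hi (permLength_lt_adjT_mul hi hv), ← mul_assoc, ih h',
      hT.mul_adj_asc _ i hi (permLength_lt_adjT_mul hi hvu), mul_assoc]

/-- The window `{a, …, a + N - 1}` inside `{0, …, n - 1}`. -/
def winEmb {a N n : ℕ} (h : a + N ≤ n) : Fin N ↪ Fin n where
  toFun j := ⟨a + j, by omega⟩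
  inj' i j hij := by
    simp only [Fin.mk.injEq, Nat.add_left_cancel_iff] at hij
    exact Fin.ext hij

/-- A permutation of the window, extended by the identity. -/
def shiftPerm {a N n : ℕ} (h : a + N ≤ n) (s : Equiv.Perm (Fin N)) : Equiv.Perm (Fin n) :=
  s.viaEmbedding (winEmb h)

section Window

variable {a N n : ℕ} (h : a + N ≤ n)

theorem winEmb_val (j : Fin N) : ((winEmb h j : Fin n) : ℕ) = a + j := rfl

theorem winEmb_lt {i j : Fin N} : winEmb h i < winEmb h j ↔ i < j := by
  simp only [Fin.lt_def, winEmb_val]; omega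

theorem mem_range_winEmb {p : Fin n} : p ∈ Set.range (winEmb h) ↔ a ≤ p ∧ (p : ℕ) < a + N := by
  constructor
  · rintro ⟨j, rfl⟩
    simp only [winEmb_val]; omega
  · rintro ⟨h1, h2⟩
    exact ⟨⟨p - a, by omega⟩, Fin.ext (by simp only [winEmb_val]; omega)⟩

theorem shiftPerm_winEmb (s : Equiv.Perm (Fin N)) (j : Fin N) :
    shiftPerm h s (winEmb h j) = winEmb h (s j) :=
  Equiv.Perm.viaEmbedding_apply s (winEmb h) j

theorem shiftPerm_of_notMem (s : Equiv.Perm (Fin N)) {p : Fin n}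
    (hp : p ∉ Set.range (winEmb h)) : shiftPerm h s p = p :=
  Equiv.Perm.viaEmbedding_apply_of_notMem s (winEmb h) p hp

theorem shiftPerm_mul (s t : Equiv.Perm (Fin N)) :
    shiftPerm h (s * t) = shiftPerm h s * shiftPerm h t :=
  map_mul (Equiv.Perm.viaEmbeddingHom (winEmb h)) s t

theorem shiftPerm_one : shiftPerm h (1 : Equiv.Perm (Fin N)) = 1 :=
  map_one (Equiv.Perm.viaEmbeddingHom (winEmb h))

theorem shiftPerm_inv (s : Equiv.Perm (Fin N)) : shiftPerm h s⁻¹ = (shiftPerm h s)⁻¹ :=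
  map_inv (Equiv.Perm.viaEmbeddingHom (winEmb h)) s

theorem shiftPerm_mem_range (s : Equiv.Perm (Fin N)) {p : Fin n} :
    shiftPerm h s p ∈ Set.range (winEmb h) ↔ p ∈ Set.range (winEmb h) := by
  constructor
  · intro hp
    by_contra hc
    rw [shiftPerm_of_notMem h s hc] at hp
    exact hc hp
  · rintro ⟨j, rfl⟩
    exact ⟨s j, (shiftPerm_winEmb h s j).symm⟩

/-- A permutation of the window reverses only pairs lying inside the window. -/
theorem shiftPerm_lt (s : Equiv.Perm (Fin N)) {p p' : Fin n} (hp : p < p')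
    (hs : ¬ (p ∈ Set.range (winEmb h) ∧ p' ∈ Set.range (winEmb h))) :
    shiftPerm h s p < shiftPerm h s p' := by
  by_cases h1 : p ∈ Set.range (winEmb h)
  · have h2 : p' ∉ Set.range (winEmb h) := fun h2 => hs ⟨h1, h2⟩
    rw [shiftPerm_of_notMem h s h2]
    have h3 := (mem_range_winEmb h).mp ((shiftPerm_mem_range h s).mpr h1)
    rw [mem_range_winEmb] at h1 h2
    rw [Fin.lt_def] at *
    omega
  · rw [shiftPerm_of_notMem h s h1]
    by_cases h2 : p' ∈ Set.range (winEmb h)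
    · have h3 := (mem_range_winEmb h).mp ((shiftPerm_mem_range h s).mpr h2)
      rw [mem_range_winEmb] at h1 h2
      rw [Fin.lt_def] at *
      omega
    · rwa [shiftPerm_of_notMem h s h2]

theorem permLength_shiftPerm (s : Equiv.Perm (Fin N)) :
    permLength (shiftPerm h s) = permLength s := by
  symm
  refine Finset.card_bij (fun p _ => (winEmb h p.1, winEmb h p.2)) ?_ ?_ ?_
  · rintro ⟨i, j⟩ hij
    simp only [Finset.mem_filter, Finset.mem_univ, true_and] at hij ⊢
    rw [shiftPerm_winEmb, shiftPerm_winEmb, winEmb_lt, winEmb_lt]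
    exact hij
  · rintro ⟨i, j⟩ _ ⟨i', j'⟩ _ hij
    simpa using hij
  · rintro ⟨p, p'⟩ hp
    simp only [Finset.mem_filter, Finset.mem_univ, true_and] at hp
    by_cases hs : p ∈ Set.range (winEmb h) ∧ p' ∈ Set.range (winEmb h)
    · obtain ⟨⟨i, rfl⟩, j, rfl⟩ := hs
      rw [shiftPerm_winEmb, shiftPerm_winEmb, winEmb_lt, winEmb_lt] at hp
      exact ⟨(i, j), by simpa using hp, rfl⟩
    · exact absurd (shiftPerm_lt h s hp.1 hs) hp.2.not_gt

theorem shiftPerm_adjT {i : ℕ} (hi : i + 1 < N) :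
    shiftPerm h (adjT i hi) = adjT (a + i) (by omega : a + i + 1 < n) := by
  ext p
  by_cases hp : p ∈ Set.range (winEmb h)
  · obtain ⟨j, rfl⟩ := hp
    rw [shiftPerm_winEmb]
    simp only [adjT, Equiv.swap_apply_def, winEmb_val, Fin.ext_iff]
    split_ifs <;> simp only [winEmb_val] at * <;> omega
  · rw [shiftPerm_of_notMem h _ hp]
    rw [mem_range_winEmb] at hp
    simp only [adjT, Equiv.swap_apply_def, Fin.ext_iff]
    split_ifs <;> simp_all <;> omega

/-- `f` is increasing on the window, i.e. it has minimal length among the products of `f` with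
permutations of the window. -/
def WinMono (f : Equiv.Perm (Fin n)) : Prop := StrictMono (f ∘ winEmb h)

theorem WinMono.lengthsAdd {f : Equiv.Perm (Fin n)} (hf : WinMono h f) (s : Equiv.Perm (Fin N)) :
    LengthsAdd f (shiftPerm h s) := by
  intro p p' hp hs
  by_cases hw : p ∈ Set.range (winEmb h) ∧ p' ∈ Set.range (winEmb h)
  · obtain ⟨⟨i, rfl⟩, j, rfl⟩ := hw
    rw [shiftPerm_winEmb, shiftPerm_winEmb, winEmb_lt] at hs
    rw [shiftPerm_winEmb, shiftPerm_winEmb]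
    exact hf hs
  · exact absurd (shiftPerm_lt h s hp hw) hs.not_gt

theorem WinMono.lengthsAdd_symm {e : Equiv.Perm (Fin n)} (he : WinMono h e⁻¹)
    (s : Equiv.Perm (Fin N)) : LengthsAdd (shiftPerm h s) e := by
  intro p p' hp hs
  refine shiftPerm_lt h s hs ?_
  rintro ⟨⟨i, hi⟩, j, hj⟩
  rw [← hi, ← hj, winEmb_lt] at hs
  have := he hs
  simp only [Function.comp_apply, hi, hj] at this
  change e.symm (e p') < e.symm (e p) at this
  rw [Equiv.symm_apply_apply, Equiv.symm_apply_apply] at this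
  exact absurd this hp.not_gt

theorem exists_winMono (w : Equiv.Perm (Fin n)) :
    ∃ f, WinMono h f ∧ ∃ s, w = f * shiftPerm h s := by
  let σ := Tuple.sort (w ∘ winEmb h)
  refine ⟨w * shiftPerm h σ, ?_, σ⁻¹, ?_⟩
  · have h1 : Monotone ((w ∘ winEmb h) ∘ σ) := Tuple.monotone_sort _
    have h2 : ((w * shiftPerm h σ : Equiv.Perm (Fin n)) : Fin n → Fin n) ∘ winEmb h =
        (w ∘ winEmb h) ∘ σ := by
      ext j
      simp [shiftPerm_winEmb]
    unfold WinMono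
    rw [h2]
    exact h1.strictMono_of_injective
      ((w.injective.comp (winEmb h).injective).comp σ.injective)
  · rw [mul_assoc, ← shiftPerm_mul, mul_inv_cancel, shiftPerm_one, mul_one]

theorem WinMono.unique {f f' : Equiv.Perm (Fin n)} (hf : WinMono h f) (hf' : WinMono h f')
    {s s' : Equiv.Perm (Fin N)} (e : f * shiftPerm h s = f' * shiftPerm h s') :
    f = f' ∧ s = s' := by
  have e1 : f = f' * shiftPerm h (s' * s⁻¹) := by
    rw [shiftPerm_mul, shiftPerm_inv, ← mul_assoc, ← e, mul_assoc, mul_inv_cancel, mul_one]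
  have e2 : s' * s⁻¹ = 1 := by
    apply perm_eq_one_of_strictMono
    intro i j hij
    have := hf hij
    simp only [e1, Function.comp_apply, Equiv.Perm.mul_apply, shiftPerm_winEmb h] at this
    exact hf'.lt_iff_lt.mp this
  rw [e2, shiftPerm_one, mul_one] at e1
  exact ⟨e1, (mul_inv_eq_one.mp e2).symm⟩

section Algebra

variable {F : Type*} [Field F] {H : Type*} [Ring H] [Algebra F H]
  {H' : Type*} [Ring H'] [Algebra F H'] {q : F}
  {T : Equiv.Perm (Fin n) → H} {T' : Equiv.Perm (Fin N) → H'}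

/-- The embedding of the Hecke algebra of the window, as a linear map. -/
theorem exists_windowMap (hT : IsHeckeBasis q T) (hT' : IsHeckeBasis q T') :
    ∃ ι : H' →ₗ[F] H, (∀ s, ι (T' s) = T (shiftPerm h s)) ∧ ∀ x y, ι (x * y) = ι x * ι y := by
  let B := Module.Basis.mk hT'.li hT'.total.ge
  let ι : H' →ₗ[F] H := B.constr F (fun s => T (shiftPerm h s))
  have hB : ∀ s, B s = T' s := fun s => Module.Basis.mk_apply _ _ s
  have hι : ∀ s, ι (T' s) = T (shiftPerm h s) := fun s => by
    rw [← hB]; exact B.constr_basis F _ s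
  have hlen : ∀ (w : Equiv.Perm (Fin N)) (i : ℕ) (hi : i + 1 < N),
      permLength (adjT (a + i) (by omega : a + i + 1 < n) * shiftPerm h w) =
        permLength (adjT i hi * w) := fun w i hi => by
    rw [← shiftPerm_adjT h hi, ← shiftPerm_mul, permLength_shiftPerm]
  have hext : ∀ f g : H' →ₗ[F] H, (∀ s, f (T' s) = g (T' s)) → f = g := fun f g hfg =>
    B.ext fun s => by rw [hB]; exact hfg s
  have adj : ∀ (x : H') (i : ℕ) (hi : i + 1 < N),
      ι (x * T' (adjT i hi)) = ι x * ι (T' (adjT i hi)) := by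
    intro x i hi
    have : ι ∘ₗ LinearMap.mulRight F (T' (adjT i hi)) =
        LinearMap.mulRight F (ι (T' (adjT i hi))) ∘ₗ ι := by
      apply hext
      intro w
      simp only [LinearMap.comp_apply, LinearMap.mulRight_apply]
      rw [hι, hι, shiftPerm_adjT h hi]
      rcases permLength_ne_adjT_mul hi w with hw | hw
      · rw [hT'.mul_adj_asc w i hi hw, hT.mul_adj_asc _ (a + i) (by omega), hι, shiftPerm_mul,
          shiftPerm_adjT h hi]
        rwa [hlen, permLength_shiftPerm]
      · rw [hT'.mul_adj_desc w i hi hw, hT.mul_adj_desc _ (a + i) (by omega), map_add, map_smul,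
          map_smul, hι, hι, shiftPerm_mul, shiftPerm_adjT h hi]
        rwa [hlen, permLength_shiftPerm]
    exact LinearMap.congr_fun this x
  refine ⟨ι, hι, fun x y => ?_⟩
  have : ι ∘ₗ LinearMap.mulLeft F x = LinearMap.mulLeft F (ι x) ∘ₗ ι := by
    apply hext
    intro w
    simp only [LinearMap.comp_apply, LinearMap.mulLeft_apply]
    induction w using perm_adjT_induction with
    | one => rw [hT'.one, mul_one, ← hT'.one, hι, shiftPerm_one, hT.one, mul_one]
    | step v i hi hv ih =>
      rw [← hT'.mul_adj_asc v i hi (permLength_lt_adjT_mul hi hv), ← mul_assoc, adj, ih, adj,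
        mul_assoc]
  exact LinearMap.congr_fun this y

/-- A sum of `z ^ l(w) T_w` over a set that is a product of a set of minimal coset
representatives and a set of permutations of the window, the latter multiplied first. -/
theorem sum_eq_windowMap_mul (hT : IsHeckeBasis q T) (ι : H' →ₗ[F] H)
    (hι : ∀ s, ι (T' s) = T (shiftPerm h s)) (z : F)
    (W G : Set (Equiv.Perm (Fin n))) (Wt : Set (Equiv.Perm (Fin N)))
    (hG : ∀ f ∈ G, WinMono h f)
    (hW : ∀ f s, WinMono h f → (f * shiftPerm h s ∈ W ↔ f ∈ G ∧ s ∈ Wt)) :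
    ∑ w ∈ Finset.univ.filter (· ∈ W), z ^ permLength w • T w =
      ι (∑ s ∈ Finset.univ.filter (· ∈ Wt), z ^ permLength s • T' s) *
        ∑ f ∈ Finset.univ.filter (· ∈ G), z ^ permLength f • T f := by
  rw [map_sum, Finset.sum_mul_sum, ← Finset.sum_product']
  symm
  refine Finset.sum_bij (fun x _ => x.2 * shiftPerm h x.1) ?_ ?_ ?_ ?_
  · rintro ⟨s, f⟩ hx
    simp only [Finset.mem_product, Finset.mem_filter, Finset.mem_univ, true_and] at hx ⊢
    exact (hW f s (hG f hx.2)).mpr ⟨hx.2, hx.1⟩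
  · rintro ⟨s, f⟩ hx ⟨s', f'⟩ hx' e
    simp only [Finset.mem_product, Finset.mem_filter, Finset.mem_univ, true_and] at hx hx'
    obtain ⟨rfl, rfl⟩ := WinMono.unique h (hG f hx.2) (hG f' hx'.2) e
    rfl
  · intro w hw
    simp only [Finset.mem_filter, Finset.mem_univ, true_and] at hw
    obtain ⟨f, hf, s, rfl⟩ := exists_winMono h w
    have := (hW f s hf).mp hw
    exact ⟨(s, f), by simpa using this.symm, rfl⟩
  · rintro ⟨s, f⟩ hx
    simp only [Finset.mem_product, Finset.mem_filter, Finset.mem_univ, true_and] at hx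
    have hadd := (hG f hx.2).lengthsAdd h s
    rw [map_smul, hι, smul_mul_smul_comm, hT.mul_of_lengthsAdd _ _ hadd, permLength_mul hadd,
      permLength_shiftPerm, pow_add, mul_comm]

/-- A sum of `T_w` over a set that is a product of a set of minimal coset representatives and
a set of permutations of the window, the former multiplied first. -/
theorem sum_eq_mul_windowMap (hT : IsHeckeBasis q T) (ι : H' →ₗ[F] H)
    (hι : ∀ s, ι (T' s) = T (shiftPerm h s))
    (D E : Set (Equiv.Perm (Fin n))) (Dt : Set (Equiv.Perm (Fin N)))
    (hE : ∀ e ∈ E, WinMono h e⁻¹)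
    (hD : ∀ e s, WinMono h e⁻¹ → (shiftPerm h s * e ∈ D ↔ e ∈ E ∧ s ∈ Dt)) :
    ∑ w ∈ Finset.univ.filter (· ∈ D), T w =
      (∑ e ∈ Finset.univ.filter (· ∈ E), T e) *
        ι (∑ s ∈ Finset.univ.filter (· ∈ Dt), T' s) := by
  rw [map_sum, Finset.sum_mul_sum, ← Finset.sum_product']
  symm
  refine Finset.sum_bij (fun x _ => shiftPerm h x.2 * x.1) ?_ ?_ ?_ ?_
  · rintro ⟨e, s⟩ hx
    simp only [Finset.mem_product, Finset.mem_filter, Finset.mem_univ, true_and] at hx ⊢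
    exact (hD e s (hE e hx.1)).mpr hx
  · rintro ⟨e, s⟩ hx ⟨e', s'⟩ hx' he
    simp only [Finset.mem_product, Finset.mem_filter, Finset.mem_univ, true_and] at hx hx'
    have he' := congrArg (·⁻¹) he
    simp only [mul_inv_rev, ← shiftPerm_inv] at he'
    obtain ⟨h1, h2⟩ := WinMono.unique h (hE e hx.1) (hE e' hx'.1) he'
    rw [inv_inj.mp h1, inv_inj.mp h2]
  · intro w hw
    simp only [Finset.mem_filter, Finset.mem_univ, true_and] at hw
    obtain ⟨f, hf, s, e⟩ := exists_winMono h w⁻¹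
    have e' : w = shiftPerm h s⁻¹ * f⁻¹ := by
      rw [shiftPerm_inv, ← mul_inv_rev, ← e, inv_inv]
    rw [e'] at hw
    have := (hD f⁻¹ s⁻¹ (by rwa [inv_inv])).mp hw
    exact ⟨(f⁻¹, s⁻¹), by simpa using this, e'.symm⟩
  · rintro ⟨e, s⟩ hx
    simp only [Finset.mem_product, Finset.mem_filter, Finset.mem_univ, true_and] at hx
    rw [hι, hT.mul_of_lengthsAdd _ _ ((hE e hx.1).lengthsAdd_symm h s)]

end Algebra

end Window

theorem exists_perm_of_card_fiber_eq {α β : Type*} [Fintype α] [DecidableEq β] (f g : α → β)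
    (hfg : ∀ b, (Finset.univ.filter (fun x => f x = b)).card =
      (Finset.univ.filter (fun x => g x = b)).card) :
    ∃ σ : Equiv.Perm α, ∀ x, f (σ x) = g x := by
  have e : ∀ b, Nonempty ({x // g x = b} ≃ {x // f x = b}) := fun b =>
    ⟨Fintype.equivOfCardEq (by rw [Fintype.card_subtype, Fintype.card_subtype, hfg b])⟩
  exact ⟨Equiv.ofFiberEquiv fun b => (e b).some, Equiv.ofFiberEquiv_map _⟩

theorem card_filter_perm {α : Type*} [Fintype α] (σ : Equiv.Perm α) (P : α → Prop)
    [DecidablePred P] [DecidablePred fun x => P (σ x)] :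
    (Finset.univ.filter (fun x => P (σ x))).card = (Finset.univ.filter P).card := by
  refine Finset.card_bij (fun x _ => σ x) (by simp) (by simp) fun y hy => ⟨σ.symm y, ?_, ?_⟩
  · simpa using hy
  · simp

/-- On every row, the words `h` and `h'` have the same multiset of entries. -/
def RowEq {n : ℕ} (row h h' : Fin n → ℕ) : Prop :=
  ∀ r v, (Finset.univ.filter (fun p => row p = r ∧ h p = v)).card =
    (Finset.univ.filter (fun p => row p = r ∧ h' p = v)).card

theorem RowEq.add_iff {n : ℕ} (row h h' : Fin n → ℕ) (b : ℕ) :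
    RowEq (fun p => row p + b) h h' ↔ RowEq row h h' := by
  constructor
  · intro H r v
    simpa using H (r + b) v
  · intro H r v
    rcases lt_or_ge r b with hr | hr
    · have : ∀ p, row p + b ≠ r := fun p => by omega
      simp [this]
    · obtain ⟨k, rfl⟩ := Nat.exists_eq_add_of_le' hr
      simpa using H k v

theorem mem_doubleCoset_iff {n : ℕ} {lam mu : ℕ → ℕ} {d w : Equiv.Perm (Fin n)} :
    w ∈ doubleCoset lam mu d ↔
      RowEq (fun p => rowOf mu (p : ℕ)) (fun p => rowOf lam ((w⁻¹ p : Fin n) : ℕ))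
        (fun p => rowOf lam ((d⁻¹ p : Fin n) : ℕ)) := by
  constructor
  · rintro ⟨u, hu, v, hv, rfl⟩ r x
    rw [← card_filter_perm v (fun p => rowOf mu (p : ℕ) = r ∧
      rowOf lam (((v * d * u)⁻¹ p : Fin n) : ℕ) = x)]
    congr 1
    refine Finset.filter_congr fun p _ => ?_
    have h1 := hv p
    have h2 := hu ((v * d * u)⁻¹ (v p))
    have h3 : u ((v * d * u)⁻¹ (v p)) = d⁻¹ p := by simp [mul_inv_rev]
    rw [h3] at h2
    rw [h1, ← h2]
  · intro H
    obtain ⟨v, hv⟩ := exists_perm_of_card_fiber_eq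
      (fun p : Fin n => (rowOf mu (p : ℕ), rowOf lam ((w⁻¹ p : Fin n) : ℕ)))
      (fun p : Fin n => (rowOf mu (p : ℕ), rowOf lam ((d⁻¹ p : Fin n) : ℕ)))
      (by
        rintro ⟨r, x⟩
        simpa only [Prod.mk.injEq] using H r x)
    simp only [Prod.mk.injEq] at hv
    refine ⟨d⁻¹ * v⁻¹ * w, fun p => ?_, v, fun p => (hv p).1, by group⟩
    have := (hv (v⁻¹ (w p))).2
    simpa using this.symm

section Window

variable {a N n : ℕ} (hN : a + N ≤ n)

theorem card_filter_window (P : Fin n → Prop) [DecidablePred P]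
    [DecidablePred fun j => P (winEmb hN j)] (hP : ∀ p, P p → p ∈ Set.range (winEmb hN)) :
    (Finset.univ.filter P).card = (Finset.univ.filter (fun j => P (winEmb hN j))).card := by
  symm
  refine Finset.card_bij (fun j _ => winEmb hN j) (by simp) (by simp) fun p hp => ?_
  simp only [Finset.mem_filter, Finset.mem_univ, true_and] at hp
  obtain ⟨j, rfl⟩ := hP p hp
  exact ⟨j, by simpa using hp, rfl⟩

/-- A weakly increasing rearrangement of the window part of a word is determined by the
content of the word outside the window. -/
theorem comp_winEmb_eq {g h : Fin n → ℕ} {gt : Fin N → ℕ} {f τ : Equiv.Perm (Fin n)}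
    {σ : Equiv.Perm (Fin N)} (hg : Monotone g) (hgt : Monotone gt) (hf : WinMono hN f)
    (hτ : ∀ p, h p = g (τ p)) (hσ : ∀ j, h (winEmb hN j) = gt (σ j))
    (hout : ∀ v, (Finset.univ.filter
        (fun p => p ∉ Set.range (winEmb hN) ∧ g (f p) = v)).card =
      (Finset.univ.filter (fun p => p ∉ Set.range (winEmb hN) ∧ h p = v)).card) :
    ∀ j, g (f (winEmb hN j)) = gt j := by
  have split : ∀ k : Fin n → ℕ, ∀ v, (Finset.univ.filter (fun p => k p = v)).card =
      (Finset.univ.filter (fun j => k (winEmb hN j) = v)).card +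
        (Finset.univ.filter (fun p => p ∉ Set.range (winEmb hN) ∧ k p = v)).card := by
    intro k v
    rw [← Finset.card_filter_add_card_filter_not (s := Finset.univ.filter (fun p => k p = v))
      (fun p => p ∈ Set.range (winEmb hN)), Finset.filter_filter, Finset.filter_filter,
      card_filter_window hN (fun p => k p = v ∧ p ∈ Set.range (winEmb hN)) fun p hp => hp.2]
    congr 2
    · ext j; simp
    · ext p; simp [and_comm]
  have fib : ∀ v, (Finset.univ.filter (fun j => g (f (winEmb hN j)) = v)).card =
      (Finset.univ.filter (fun j => gt j = v)).card := by
    intro v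
    have h1 := split (fun p => g (f p)) v
    have h2 := split h v
    have h3 : (Finset.univ.filter (fun p => g (f p) = v)).card =
        (Finset.univ.filter (fun p => h p = v)).card := by
      simp only [hτ]
      rw [card_filter_perm f (fun p => g p = v), card_filter_perm τ (fun p => g p = v)]
    have h4 : (Finset.univ.filter (fun j => h (winEmb hN j) = v)).card =
        (Finset.univ.filter (fun j => gt j = v)).card := by
      simp only [hσ]
      rw [card_filter_perm σ (fun p => gt p = v)]
    have h5 := hout v
    omega
  obtain ⟨ρ, hρ⟩ := exists_perm_of_card_fiber_eq (fun j => g (f (winEmb hN j))) gt fib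
  have hmono : Monotone (fun j => g (f (winEmb hN j))) := hg.comp hf.monotone
  have := Tuple.unique_monotone (f := fun j => g (f (winEmb hN j))) (σ := 1) (τ := ρ)
    (by simpa using hmono) (by
      have e : (fun j => g (f (winEmb hN j))) ∘ ρ = gt := funext hρ
      rw [e]; exact hgt)
  intro j
  have hj := congrFun this j
  simp only [Function.comp_apply, Equiv.Perm.one_apply] at hj
  rw [hj]
  exact hρ j

/-- The words `k` and `h` have the same contents on the rows that avoid the window. -/
def OutEq (row k h : Fin n → ℕ) : Prop :=
  ∀ r, (∀ j, row (winEmb hN j) ≠ r) → ∀ v,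
    (Finset.univ.filter (fun p => row p = r ∧ k p = v)).card =
      (Finset.univ.filter (fun p => row p = r ∧ h p = v)).card

theorem rowEq_comp_shiftPerm_iff {row : Fin n → ℕ}
    (hrow : ∀ p ∉ Set.range (winEmb hN), ∀ j, row (winEmb hN j) ≠ row p)
    (k h : Fin n → ℕ) (s : Equiv.Perm (Fin N)) :
    RowEq row (fun p => k (shiftPerm hN s p)) h ↔
      OutEq hN row k h ∧ RowEq (fun j => row (winEmb hN j)) (fun j => k (winEmb hN (s j)))
        (fun j => h (winEmb hN j)) := by
  have inside : ∀ j, ∀ k : Fin n → ℕ, ∀ v,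
      (Finset.univ.filter (fun p => row p = row (winEmb hN j) ∧ k p = v)).card =
      (Finset.univ.filter (fun i => row (winEmb hN i) = row (winEmb hN j) ∧
        k (winEmb hN i) = v)).card := by
    intro j k v
    apply card_filter_window hN
    intro p hp
    by_contra hc
    exact hrow p hc j hp.1.symm
  have outside : ∀ r, (∀ j, row (winEmb hN j) ≠ r) → ∀ v,
      (Finset.univ.filter (fun p => row p = r ∧ k (shiftPerm hN s p) = v)).card =
      (Finset.univ.filter (fun p => row p = r ∧ k p = v)).card := by
    intro r hr v
    congr 1
    refine Finset.filter_congr fun p _ => and_congr_right fun hp => ?_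
    rw [shiftPerm_of_notMem]
    rintro ⟨j, rfl⟩
    exact hr j hp
  constructor
  · intro H
    refine ⟨fun r hr v => ?_, fun r v => ?_⟩
    · rw [← outside r hr, H]
    · by_cases hr : ∃ j, row (winEmb hN j) = r
      · obtain ⟨j, rfl⟩ := hr
        have := H (row (winEmb hN j)) v
        rw [inside j, inside j] at this
        simpa only [shiftPerm_winEmb] using this
      · push Not at hr
        simp [hr]
  · rintro ⟨H1, H2⟩ r v
    by_cases hr : ∃ j, row (winEmb hN j) = r
    · obtain ⟨j, rfl⟩ := hr
      have := H2 (row (winEmb hN j)) v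
      rw [inside j (fun p => k (shiftPerm hN s p)), inside j]
      simpa only [shiftPerm_winEmb] using this
    · push Not at hr
      rw [outside r hr, H1 r hr]

theorem OutEq.card_eq {row k h : Fin n → ℕ} (H : OutEq hN row k h)
    (hrow : ∀ p ∉ Set.range (winEmb hN), ∀ j, row (winEmb hN j) ≠ row p) (v : ℕ) :
    (Finset.univ.filter (fun p => p ∉ Set.range (winEmb hN) ∧ k p = v)).card =
      (Finset.univ.filter (fun p => p ∉ Set.range (winEmb hN) ∧ h p = v)).card := by
  have fiber : ∀ k : Fin n → ℕ,
      (Finset.univ.filter (fun p => p ∉ Set.range (winEmb hN) ∧ k p = v)).card =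
      ∑ r ∈ (Finset.univ.image row).filter (fun r => ∀ j, row (winEmb hN j) ≠ r),
        (Finset.univ.filter (fun p => row p = r ∧ k p = v)).card := by
    intro k
    rw [Finset.card_eq_sum_card_fiberwise (f := row)
      (t := (Finset.univ.image row).filter (fun r => ∀ j, row (winEmb hN j) ≠ r))]
    · refine Finset.sum_congr rfl fun r hr => ?_
      rw [Finset.filter_filter]
      congr 1
      refine Finset.filter_congr fun p _ => ?_
      constructor
      · rintro ⟨⟨-, h2⟩, h3⟩; exact ⟨h3, h2⟩
      · rintro ⟨h1, h2⟩
        refine ⟨⟨?_, h2⟩, h1⟩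
        rintro ⟨j, rfl⟩
        exact (Finset.mem_filter.mp hr).2 j h1
    · intro p hp
      have hp' := (Finset.mem_filter.mp hp).2
      exact Finset.mem_coe.mpr (Finset.mem_filter.mpr
        ⟨Finset.mem_image_of_mem _ (Finset.mem_univ _), hrow p hp'.1⟩)
  rw [fiber, fiber]
  exact Finset.sum_congr rfl fun r hr => H r (Finset.mem_filter.mp hr).2 v

theorem OutEq.congr_right {row k h h' : Fin n → ℕ}
    (hh : ∀ p ∉ Set.range (winEmb hN), h p = h' p) :
    OutEq hN row k h ↔ OutEq hN row k h' := by
  refine forall_congr' fun r => forall_congr' fun hr => forall_congr' fun v => ?_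
  have : Finset.univ.filter (fun p => row p = r ∧ h p = v) =
      Finset.univ.filter (fun p => row p = r ∧ h' p = v) := by
    refine Finset.filter_congr fun p _ => and_congr_right fun hp => ?_
    rw [hh p]
    rintro ⟨j, rfl⟩
    exact hr j hp
  rw [this]

end Window

theorem cumSum_succ (lam : ℕ → ℕ) (r : ℕ) : cumSum lam (r + 1) = cumSum lam r + lam r :=
  Finset.sum_range_succ _ _

theorem cumSum_mono (lam : ℕ → ℕ) : Monotone (cumSum lam) :=
  monotone_nat_of_le_succ fun r => by rw [cumSum_succ]; omega

theorem rowOf_eq {lam : ℕ → ℕ} {p r : ℕ} (h1 : cumSum lam r ≤ p) (h2 : p < cumSum lam (r + 1)) :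
    rowOf lam p = r := by
  apply le_antisymm
  · exact Nat.sInf_le h2
  · by_contra hc
    have h3 : p < cumSum lam (rowOf lam p + 1) := Nat.sInf_mem (s := {r | p < cumSum lam (r + 1)})
      ⟨r, h2⟩
    have := cumSum_mono lam (show rowOf lam p + 1 ≤ r by omega)
    omega

theorem lt_cumSum_rowOf {lam : ℕ → ℕ} {p : ℕ} (h : ∃ r, p < cumSum lam (r + 1)) :
    p < cumSum lam (rowOf lam p + 1) :=
  Nat.sInf_mem (s := {r | p < cumSum lam (r + 1)}) h

theorem cumSum_rowOf_le (lam : ℕ → ℕ) (p : ℕ) : cumSum lam (rowOf lam p) ≤ p := by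
  rcases hr : rowOf lam p with _ | r
  · simp [cumSum]
  · have : r ∉ {r | p < cumSum lam (r + 1)} :=
      Nat.notMem_of_lt_sInf (by change r < rowOf lam p; omega)
    exact not_lt.mp this

theorem rowOf_monotone {lam : ℕ → ℕ} {n : ℕ} (h : ∀ p < n, ∃ r, p < cumSum lam (r + 1)) :
    Monotone (fun p : Fin n => rowOf lam (p : ℕ)) := by
  intro p p' hp
  have := lt_cumSum_rowOf (h p' p'.2)
  have hp' : (p : ℕ) < cumSum lam (rowOf lam (p' : ℕ) + 1) := lt_of_le_of_lt hp this
  exact Nat.sInf_le hp'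

theorem IsComposition.cumSum_le {n : ℕ} {lam : ℕ → ℕ} (h : IsComposition n lam) (r : ℕ) :
    cumSum lam r ≤ n := by
  obtain ⟨N, h0, rfl⟩ := h
  rcases le_total r N with hr | hr
  · exact cumSum_mono lam hr
  · refine le_of_eq (Finset.sum_subset (Finset.range_mono hr) fun x _ hx => h0 x ?_).symm
    simpa using hx

theorem IsComposition.exists_lt_cumSum {n : ℕ} {lam : ℕ → ℕ} (h : IsComposition n lam) :
    ∀ p < n, ∃ r, p < cumSum lam (r + 1) := by
  obtain ⟨N, -, h1⟩ := h
  exact fun p hp => ⟨N, by have := cumSum_mono lam (Nat.le_add_right N 1); omega⟩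

section Column

variable {n : ℕ} {mu : ℕ → ℕ}

theorem rowOf_cumSum_add {r c : ℕ} (h : c < mu r) : rowOf mu (cumSum mu r + c) = r :=
  rowOf_eq (by omega) (by rw [cumSum_succ]; omega)

theorem lt_conjP_iff (hmu : IsPartition n mu) {r c : ℕ} : r < conjP mu c ↔ c < mu r := by
  constructor
  · intro h
    have : r ∉ {r | mu r ≤ c} := Nat.notMem_of_lt_sInf h
    simpa using this
  · intro h
    by_contra hc
    obtain ⟨⟨N, h0, -⟩, hanti⟩ := hmu
    have h1 : mu (conjP mu c) ≤ c :=
      Nat.sInf_mem (s := {r | mu r ≤ c}) ⟨N, by simp [h0 N le_rfl]⟩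
    have := hanti (not_lt.mp hc)
    omega

theorem card_colIdx_eq (hmu : IsPartition n mu) (c : ℕ) :
    (Finset.univ.filter (fun p : Fin n => colIdx mu (p : ℕ) = c)).card = conjP mu c := by
  rw [← Finset.card_range (conjP mu c)]
  refine Finset.card_bij (fun p _ => rowOf mu (p : ℕ)) ?_ ?_ ?_
  · intro p hp
    simp only [Finset.mem_filter, Finset.mem_univ, true_and] at hp
    unfold colIdx at hp
    rw [Finset.mem_range, lt_conjP_iff hmu]
    have h1 := lt_cumSum_rowOf (hmu.1.exists_lt_cumSum p p.2)
    have h2 := cumSum_rowOf_le mu p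
    rw [cumSum_succ] at h1
    omega
  · intro p hp p' hp' e
    simp only [Finset.mem_filter, Finset.mem_univ, true_and] at hp hp'
    unfold colIdx at hp hp'
    have h2 := cumSum_rowOf_le mu p
    have h2' := cumSum_rowOf_le mu p'
    rw [← e] at hp' h2'
    exact Fin.ext (by omega)
  · intro r hr
    rw [Finset.mem_range, lt_conjP_iff hmu] at hr
    have h1 := hmu.1.cumSum_le (r + 1)
    rw [cumSum_succ] at h1
    refine ⟨⟨cumSum mu r + c, by omega⟩, ?_, rowOf_cumSum_add hr⟩
    rw [Finset.mem_filter]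
    simp [colIdx, rowOf_cumSum_add hr]

theorem card_colIdx_lt (hmu : IsPartition n mu) (c : ℕ) :
    (Finset.univ.filter (fun p : Fin n => colIdx mu (p : ℕ) < c)).card =
      cumSum (conjP mu) c := by
  induction c with
  | zero => simp [cumSum]
  | succ c ih =>
    rw [cumSum_succ, ← ih, ← card_colIdx_eq hmu c, ← Finset.card_union_of_disjoint]
    · congr 1
      ext p
      simp only [Finset.mem_filter, Finset.mem_univ, true_and, Finset.mem_union]
      omega
    · rw [Finset.disjoint_left]
      intro p h1 h2
      simp only [Finset.mem_filter, Finset.mem_univ, true_and] at h1 h2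
      omega

variable {w : Equiv.Perm (Fin n)}

theorem IsWmu.bounds (hmu : IsPartition n mu) (hw : IsWmu mu w) (p : Fin n) :
    cumSum (conjP mu) (colIdx mu p) ≤ (w p : Fin n) ∧
      ((w p : Fin n) : ℕ) < cumSum (conjP mu) (colIdx mu p + 1) := by
  rw [hw p, ← card_colIdx_lt hmu, ← card_colIdx_lt hmu]
  constructor
  · refine Finset.card_le_card fun p' hp' => ?_
    simp only [Finset.mem_filter, Finset.mem_univ, true_and] at hp' ⊢
    exact Or.inl hp'
  · refine Finset.card_lt_card ⟨fun p' hp' => ?_, fun hs => ?_⟩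
    · simp only [Finset.mem_filter, Finset.mem_univ, true_and] at hp' ⊢
      omega
    · have := hs (show p ∈ _ by simp)
      simp at this

theorem IsWmu.rowOf_conjP (hmu : IsPartition n mu) (hw : IsWmu mu w) (p : Fin n) :
    rowOf (conjP mu) (w p : Fin n) = colIdx mu p :=
  rowOf_eq (hw.bounds hmu p).1 (hw.bounds hmu p).2

theorem IsWmu.rowOf_conjP_monotone (hmu : IsPartition n mu) (hw : IsWmu mu w) :
    Monotone (fun p : Fin n => rowOf (conjP mu) (p : ℕ)) := by
  refine rowOf_monotone fun p hp => ⟨colIdx mu (w.symm ⟨p, hp⟩), ?_⟩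
  simpa using (hw.bounds hmu (w.symm ⟨p, hp⟩)).2

theorem IsWmu.lengthsAdd (hmu : IsPartition n mu) (hw : IsWmu mu w) {v : Equiv.Perm (Fin n)}
    (hv : v ∈ youngW (conjP mu)) : LengthsAdd v w := by
  intro p p' hp hlt
  have hcol : colIdx mu (p' : ℕ) < colIdx mu (p : ℕ) := by
    by_contra hc
    refine absurd hlt (not_lt.mpr ?_)
    rw [Fin.le_def, hw p, hw p']
    refine Finset.card_le_card fun t ht => ?_
    simp only [Finset.mem_filter, Finset.mem_univ, true_and] at ht ⊢
    have hr : rowOf mu (p : ℕ) ≤ rowOf mu (p' : ℕ) :=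
      rowOf_monotone hmu.1.exists_lt_cumSum hp.le
    omega
  rw [← hw.rowOf_conjP hmu, ← hw.rowOf_conjP hmu, ← hv (w p), ← hv (w p')] at hcol
  exact (hw.rowOf_conjP_monotone hmu).reflect_lt hcol

/-- The permutations sending the nodes in column `c` to the positions in row `c` of the
conjugate partition, for all `c`. -/
def columnSet {n : ℕ} (mu : ℕ → ℕ) : Set (Equiv.Perm (Fin n)) :=
  {x | ∀ p, rowOf (conjP mu) (x p : Fin n) = colIdx mu p}

theorem IsWmu.smul_mul_yElt {F : Type*} [Field F] {H : Type*} [Ring H] [Algebra F H] {q : F}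
    {T : Equiv.Perm (Fin n) → H} (hT : IsHeckeBasis q T) (hmu : IsPartition n mu)
    (hw : IsWmu mu w) :
    ((-q)⁻¹) ^ permLength w • (T w * yElt q T (conjP mu)) =
      ∑ x ∈ Finset.univ.filter (· ∈ columnSet mu), ((-q)⁻¹) ^ permLength x • T x := by
  unfold yElt
  rw [Finset.mul_sum, Finset.smul_sum]
  refine Finset.sum_bij (fun v _ => v * w) ?_ ?_ ?_ ?_
  · intro v hv
    simp only [Finset.mem_filter, Finset.mem_univ, true_and] at hv ⊢
    intro p
    rw [Equiv.Perm.mul_apply, hv (w p), hw.rowOf_conjP hmu]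
  · intro v _ v' _ e
    exact mul_right_cancel e
  · intro x hx
    simp only [Finset.mem_filter, Finset.mem_univ, true_and] at hx
    refine ⟨x * w⁻¹, ?_, by group⟩
    simp only [Finset.mem_filter, Finset.mem_univ, true_and]
    intro p
    rw [Equiv.Perm.mul_apply, hx, ← hw.rowOf_conjP hmu]
    simp
  · intro v hv
    simp only [Finset.mem_filter, Finset.mem_univ, true_and] at hv
    have hadd := hw.lengthsAdd hmu hv
    rw [mul_smul_comm, hT.mul_of_lengthsAdd _ _ hadd, permLength_mul hadd, smul_smul, pow_add,
      mul_comm]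

end Column

section RowWindow

/-- The sequence `(x b, …, x (m - 1), 0, 0, …)`. -/
def rowWindow {α : Type*} [Zero α] (x : ℕ → α) (b m : ℕ) : ℕ → α :=
  fun s => if s < m - b then x (s + b) else 0

theorem rowWindow_of_lt {α : Type*} [Zero α] (x : ℕ → α) {b m s : ℕ} (hs : s < m - b) :
    rowWindow x b m s = x (s + b) := if_pos hs

theorem rowWindow_of_le {α : Type*} [Zero α] (x : ℕ → α) {b m s : ℕ} (hs : m - b ≤ s) :
    rowWindow x b m s = 0 := if_neg (by omega)

variable {n b m : ℕ} {mu : ℕ → ℕ}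

theorem cumSum_add_sum_Ico (mu : ℕ → ℕ) (hbm : b ≤ m) :
    cumSum mu b + ∑ s ∈ Finset.Ico b m, mu s = cumSum mu m :=
  Finset.sum_range_add_sum_Ico _ hbm

theorem cumSum_rowWindow (mu : ℕ → ℕ) {k : ℕ} (hk : k ≤ m - b) :
    cumSum (rowWindow mu b m) k + cumSum mu b = cumSum mu (k + b) := by
  induction k with
  | zero => simp [cumSum]
  | succ k ih =>
    have e : k + 1 + b = (k + b) + 1 := by omega
    rw [e, cumSum_succ, cumSum_succ, ← ih (by omega), rowWindow_of_lt mu (by omega)]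
    omega

theorem isPartition_rowWindow (hmu : IsPartition n mu) (hbm : b ≤ m) :
    IsPartition (∑ s ∈ Finset.Ico b m, mu s) (rowWindow mu b m) := by
  refine ⟨⟨m - b, fun r hr => rowWindow_of_le mu hr, ?_⟩, fun r r' hr => ?_⟩
  · have h1 := cumSum_rowWindow (b := b) (m := m) mu le_rfl
    have h2 := cumSum_add_sum_Ico mu hbm
    rw [Nat.sub_add_cancel hbm] at h1
    omega
  · have := hmu.2 (show r + b ≤ r' + b by omega)
    unfold rowWindow
    split_ifs <;> omega

theorem rowOf_window (hmu : IsPartition n mu) (hbm : b ≤ m)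
    (j : Fin (∑ s ∈ Finset.Ico b m, mu s)) :
    rowOf (rowWindow mu b m) (j : ℕ) < m - b ∧
      rowOf mu (cumSum mu b + j) = rowOf (rowWindow mu b m) (j : ℕ) + b ∧
      colIdx mu (cumSum mu b + j) = colIdx (rowWindow mu b m) (j : ℕ) := by
  have hw := isPartition_rowWindow (b := b) hmu hbm
  set nu := rowWindow mu b m with hnu
  have h1 := cumSum_rowOf_le nu j
  have h2 := lt_cumSum_rowOf (hw.1.exists_lt_cumSum j j.2)
  have h3 : rowOf nu j < m - b := by
    by_contra hc
    rw [cumSum_succ, hnu, rowWindow_of_le mu (not_lt.mp hc)] at h2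
    rw [hnu] at h1
    omega
  have e1 := cumSum_rowWindow (b := b) (m := m) mu h3.le
  have e2 := cumSum_rowWindow (b := b) (m := m) mu (k := rowOf nu j + 1) h3
  rw [← hnu] at e1 e2
  have h4 : rowOf mu (cumSum mu b + j) = rowOf nu (j : ℕ) + b := by
    apply rowOf_eq
    · omega
    · rw [show rowOf nu (j : ℕ) + b + 1 = rowOf nu (j : ℕ) + 1 + b by omega]
      omega
  refine ⟨h3, h4, ?_⟩
  unfold colIdx
  rw [h4]
  omega

theorem rowOf_of_notMem_window (hmu : IsPartition n mu) (hbm : b ≤ m)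
    (hN : cumSum mu b + ∑ s ∈ Finset.Ico b m, mu s ≤ n) {p : Fin n}
    (hp : p ∉ Set.range (winEmb hN)) : rowOf mu (p : ℕ) < b ∨ m ≤ rowOf mu (p : ℕ) := by
  rw [mem_range_winEmb, cumSum_add_sum_Ico mu hbm] at hp
  by_contra! hc
  have h1 := cumSum_rowOf_le mu p
  have h2 := lt_cumSum_rowOf (hmu.1.exists_lt_cumSum p p.2)
  have h3 := cumSum_mono mu hc.1
  have h4 := cumSum_mono mu (show rowOf mu (p : ℕ) + 1 ≤ m from hc.2)
  exact hp ⟨by omega, by omega⟩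

theorem exists_lt_cumSum_of_hasType {k N : ℕ} {A : ℕ → Multiset ℕ} {nu lam : ℕ → ℕ}
    (hA : RowsOfShape nu A) (hk : ∀ s, k ≤ s → A s = 0) (hN : N ≤ cumSum nu k)
    (ht : HasType A lam) : ∀ p < N, ∃ r, p < cumSum lam (r + 1) := by
  intro p hp
  let S : Multiset ℕ := ∑ s ∈ Finset.range k, A s
  have hcount : ∀ v, S.count v = lam v := by
    intro v
    rw [← ht v, Multiset.count_sum']
    refine (finsum_eq_sum_of_support_subset _ fun s hs => ?_).symm
    by_contra hc
    simp only [Finset.coe_range, Set.mem_Iio, not_lt] at hc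
    simp [hk s hc] at hs
  have hcard : S.card = cumSum nu k := by
    rw [cumSum, Multiset.card_sum]
    exact Finset.sum_congr rfl fun s _ => hA s
  refine ⟨S.toFinset.sup id, ?_⟩
  have : cumSum lam (S.toFinset.sup id + 1) = S.card := by
    rw [← Multiset.sum_count_eq_card (s := Finset.range (S.toFinset.sup id + 1))]
    · exact Finset.sum_congr rfl fun v _ => (hcount v).symm
    · intro v hv
      rw [Finset.mem_range, Nat.lt_succ_iff]
      exact Finset.le_sup (f := id) (Multiset.mem_toFinset.mpr hv)
  omega

end RowWindow

section Factorization

variable {F : Type*} [Field F] {H : Type*} [Ring H] [Algebra F H]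
  {H' : Type*} [Ring H'] [Algebra F H'] {q : F} {n b m : ℕ} {mu : ℕ → ℕ}
  {T : Equiv.Perm (Fin n) → H} {T' : Equiv.Perm (Fin (∑ s ∈ Finset.Ico b m, mu s)) → H'}

theorem rowOf_winEmb_ne (hmu : IsPartition n mu) (hbm : b ≤ m)
    (hN : cumSum mu b + ∑ s ∈ Finset.Ico b m, mu s ≤ n) {p : Fin n}
    (hp : p ∉ Set.range (winEmb hN)) (j : Fin (∑ s ∈ Finset.Ico b m, mu s)) :
    rowOf mu (winEmb hN j : Fin n) ≠ rowOf mu (p : ℕ) := by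
  rw [winEmb_val]
  have h1 := rowOf_window hmu hbm j
  have h2 := rowOf_of_notMem_window hmu hbm hN hp
  omega

/-- The permutations that are increasing on the window and send the nodes in column `c`
outside the window to the positions in row `c` of the conjugate partition. -/
def outerColumnSet {a N n : ℕ} (hN : a + N ≤ n) (mu : ℕ → ℕ) : Set (Equiv.Perm (Fin n)) :=
  {f | WinMono hN f ∧ ∀ p ∉ Set.range (winEmb hN),
    rowOf (conjP mu) (f p : Fin n) = colIdx mu (p : ℕ)}

/-- The permutations with inverse increasing on the window, whose word has the same contents as
`k` on the rows outside the window. -/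
def outerRowSet {a N n : ℕ} (hN : a + N ≤ n) (lam mu : ℕ → ℕ) (k : Fin n → ℕ) :
    Set (Equiv.Perm (Fin n)) :=
  {e | WinMono hN e⁻¹ ∧
    OutEq hN (fun p => rowOf mu (p : ℕ)) (fun p => rowOf lam (e⁻¹ p : Fin n)) k}

theorem outerRowSet_congr {a N n : ℕ} (hN : a + N ≤ n) (lam mu : ℕ → ℕ) {k k' : Fin n → ℕ}
    (hk : ∀ p ∉ Set.range (winEmb hN), k p = k' p) :
    outerRowSet hN lam mu k = outerRowSet hN lam mu k' :=
  Set.ext fun _ => and_congr_right fun _ => OutEq.congr_right hN hk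

/-- The generator `T_{w_μ} y_{μ'}` factors through the one of the window. -/
theorem exists_mul_yElt_eq (hT : IsHeckeBasis q T) (hT' : IsHeckeBasis q T') (hq : q ≠ 0)
    (hmu : IsPartition n mu) (hbm : b ≤ m)
    (hN : cumSum mu b + ∑ s ∈ Finset.Ico b m, mu s ≤ n) (ι : H' →ₗ[F] H)
    (hι : ∀ s, ι (T' s) = T (shiftPerm hN s)) {w : Equiv.Perm (Fin n)} (hw : IsWmu mu w)
    {wt : Equiv.Perm (Fin (∑ s ∈ Finset.Ico b m, mu s))} (hwt : IsWmu (rowWindow mu b m) wt) :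
    ∃ x : H, T w * yElt q T (conjP mu) =
      ι (T' wt * yElt q T' (conjP (rowWindow mu b m))) * x := by
  have hmut := isPartition_rowWindow (b := b) hmu hbm
  have hz : ∀ k : ℕ, ((-q)⁻¹) ^ k ≠ 0 := fun k => pow_ne_zero _ (inv_ne_zero (neg_ne_zero.mpr hq))
  have h1 := hw.smul_mul_yElt hT hmu
  have h2 := hwt.smul_mul_yElt hT' hmut
  have hcol : ∀ j, colIdx mu (winEmb hN j : Fin n) = colIdx (rowWindow mu b m) (j : ℕ) :=
    fun j => (rowOf_window hmu hbm j).2.2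
  rw [sum_eq_windowMap_mul hN hT ι hι ((-q)⁻¹) (columnSet mu) (outerColumnSet hN mu)
    (columnSet (rowWindow mu b m)) (fun f hf => hf.1), ← h2] at h1
  · rw [map_smul, smul_mul_assoc] at h1
    refine ⟨(((-q)⁻¹) ^ permLength w)⁻¹ • ((-q)⁻¹) ^ permLength wt •
      ∑ f ∈ Finset.univ.filter (· ∈ outerColumnSet hN mu), ((-q)⁻¹) ^ permLength f • T f, ?_⟩
    rw [mul_smul_comm, mul_smul_comm, ← h1, inv_smul_smul₀ (hz _)]
  · intro f s hf
    have hwin : (∀ p ∉ Set.range (winEmb hN), rowOf (conjP mu) (f p : Fin n) = colIdx mu (p : ℕ)) →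
        ∀ j, rowOf (conjP mu) (f (winEmb hN j) : Fin n) =
          rowOf (conjP (rowWindow mu b m)) (j : ℕ) := by
      intro hout
      refine comp_winEmb_eq hN (g := fun p : Fin n => rowOf (conjP mu) (p : ℕ))
        (h := fun p : Fin n => colIdx mu (p : ℕ))
        (gt := fun j => rowOf (conjP (rowWindow mu b m)) (j : ℕ)) (τ := w) (σ := wt)
        (hw.rowOf_conjP_monotone hmu) (hwt.rowOf_conjP_monotone hmut) hf
        (fun p => (hw.rowOf_conjP hmu p).symm)
        (fun j => by rw [hcol, hwt.rowOf_conjP hmut]) fun v => ?_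
      congr 1
      refine Finset.filter_congr fun p _ => and_congr_right fun hp => ?_
      rw [hout p hp]
    simp only [columnSet, outerColumnSet, Set.mem_ofPred_eq, Equiv.Perm.mul_apply]
    constructor
    · intro hall
      have hout : ∀ p ∉ Set.range (winEmb hN),
          rowOf (conjP mu) (f p : Fin n) = colIdx mu (p : ℕ) := fun p hp => by
        rw [← hall p, shiftPerm_of_notMem hN s hp]
      refine ⟨⟨hf, hout⟩, fun j => ?_⟩
      rw [← hwin hout, ← hcol, ← hall, shiftPerm_winEmb]
    · rintro ⟨⟨-, hout⟩, hs⟩ p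
      by_cases hp : p ∈ Set.range (winEmb hN)
      · obtain ⟨j, rfl⟩ := hp
        rw [shiftPerm_winEmb, hwin hout, hs, hcol]
      · rw [shiftPerm_of_notMem hN s hp, hout p hp]

/-- If the word of `1_A` restricts to the word of `1_Ã` on the window, then `x_μ φ_A` is a
product whose right factor is the image of `x_μ̃ φ_Ã`, while the left factor depends only on
the rows outside the window. -/
theorem XPhi_eq_mul (hT : IsHeckeBasis q T) (hmu : IsPartition n mu) (hbm : b ≤ m)
    (hN : cumSum mu b + ∑ s ∈ Finset.Ico b m, mu s ≤ n) (ι : H' →ₗ[F] H)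
    (hι : ∀ s, ι (T' s) = T (shiftPerm hN s)) {lam lamt : ℕ → ℕ}
    (hlam : ∀ p < n, ∃ r, p < cumSum lam (r + 1))
    (hlamt : ∀ p < ∑ s ∈ Finset.Ico b m, mu s, ∃ r, p < cumSum lamt (r + 1))
    {d : Equiv.Perm (Fin n)} {dt : Equiv.Perm (Fin (∑ s ∈ Finset.Ico b m, mu s))}
    (hd : ∀ j, rowOf lam (d⁻¹ (winEmb hN j) : Fin n) = rowOf lamt (dt⁻¹ j : Fin _)) :
    XPhi T lam mu d =
      (∑ e ∈ Finset.univ.filter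
          (· ∈ outerRowSet hN lam mu (fun p => rowOf lam (d⁻¹ p : Fin n))), T e) *
        ι (XPhi T' lamt (rowWindow mu b m) dt) := by
  unfold XPhi
  have hrow : ∀ p ∉ Set.range (winEmb hN), ∀ j,
      rowOf mu (winEmb hN j : Fin n) ≠ rowOf mu (p : ℕ) :=
    fun p hp j => rowOf_winEmb_ne hmu hbm hN hp j
  have hrow' : (fun j => rowOf mu (winEmb hN j : Fin n)) =
      fun j : Fin (∑ s ∈ Finset.Ico b m, mu s) => rowOf (rowWindow mu b m) (j : ℕ) + b :=
    funext fun j => (rowOf_window hmu hbm j).2.1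
  refine sum_eq_mul_windowMap hN hT ι hι (doubleCoset lam mu d) (outerRowSet hN lam mu _)
    (doubleCoset lamt (rowWindow mu b m) dt) (fun e he => he.1) fun e s he => ?_
  have e1 : ∀ p, (shiftPerm hN s * e)⁻¹ p = e⁻¹ (shiftPerm hN s⁻¹ p) := fun p => by
    rw [mul_inv_rev, shiftPerm_inv, Equiv.Perm.mul_apply]
  rw [mem_doubleCoset_iff, mem_doubleCoset_iff, outerRowSet, Set.mem_ofPred_eq]
  simp only [e1]
  rw [rowEq_comp_shiftPerm_iff hN (row := fun p : Fin n => rowOf mu (p : ℕ)) hrow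
    (fun p => rowOf lam (e⁻¹ p : Fin n)), hrow', RowEq.add_iff, and_assoc,
    and_iff_right (show WinMono hN e⁻¹ from he)]
  refine and_congr_right fun hout => ?_
  have hwin := comp_winEmb_eq hN (g := fun p : Fin n => rowOf lam (p : ℕ))
    (h := fun p => rowOf lam (d⁻¹ p : Fin n)) (gt := fun j => rowOf lamt (j : ℕ))
    (τ := d⁻¹) (σ := dt⁻¹) (rowOf_monotone hlam) (rowOf_monotone hlamt) he (fun _ => rfl) hd
    (hout.card_eq hN hrow)
  simp only [hwin, hd]

end Factorization

/-- The word of `1_A` reads off the entries of `A`. -/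
theorem Is1A.rowOf_inv {n : ℕ} {mu lam : ℕ → ℕ} {A : ℕ → Multiset ℕ} {d : Equiv.Perm (Fin n)}
    (hd : Is1A mu lam A d) (p : Fin n) :
    rowOf lam (d⁻¹ p : Fin n) = entryAt A (rowOf mu (p : ℕ)) (colIdx mu (p : ℕ)) := by
  have := hd.2 (d⁻¹ p)
  have e : d (d⁻¹ p) = p := d.apply_symm_apply p
  rw [e] at this
  exact this.symm

theorem apply_mk_mul {H : Type*} [Ring H] {x g : H} {M : Submodule Hᵐᵒᵖ H} (hx : x ∈ M)
    (φ : M →ₗ[Hᵐᵒᵖ] H) (h : x * g ∈ M) : φ ⟨x * g, h⟩ = φ ⟨x, hx⟩ * g := by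
  have : (⟨x * g, h⟩ : M) = MulOpposite.op g • ⟨x, hx⟩ := rfl
  rw [this, map_smul]
  rfl

/-- Theorem: removing rows outside a window preserves relations.
`μ ⊢ n`, `λ ⊨ n`, `1 ≤ l < m`; `μ̃ = (μ_l, …, μ_m)`, `ñ = μ_l + ⋯ + μ_m`;
`A_1,…,A_r` row-standard `μ`-tableaux of type `λ` identical outside rows `l,…,m`
(1-indexed); `Ã_i` obtained by keeping only rows `l,…,m`, of common type `λ̃ ⊨ ñ`.
If `∑ c_i φ̂_{Ã_i} = 0` (homomorphisms `S^{μ̃} → M^{λ̃}` over `H_{ñ}`) then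
`∑ c_i φ̂_{A_i} = 0` (homomorphisms `S^μ → M^λ` over `H_n`). -/
theorem row_removal_window
    {F : Type*} [Field F] {H : Type*} [Ring H] [Algebra F H]
    {H' : Type*} [Ring H'] [Algebra F H']
    {n : ℕ} (q : F) (hq : q ≠ 0)
    (l m : ℕ) (hl : 1 ≤ l) (hlm : l < m)
    (mu lam : ℕ → ℕ) (hmu : IsPartition n mu) (hlam : IsComposition n lam)
    (T : Equiv.Perm (Fin n) → H) (hT : IsHeckeBasis q T)
    (T' : Equiv.Perm (Fin (∑ s ∈ Finset.Ico (l-1) m, mu s)) → H')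
    (hT' : IsHeckeBasis q T')
    (r : ℕ) (A : Fin r → ℕ → Multiset ℕ) (c : Fin r → F)
    (hshape : ∀ i, RowsOfShape mu (A i)) (htype : ∀ i, HasType (A i) lam)
    (houtside : ∀ i j s, (s < l - 1 ∨ m ≤ s) → A i s = A j s)
    (lamt : ℕ → ℕ)
    (hlamt : ∀ i, HasType (fun s => if s < m - (l-1) then A i (s + (l-1)) else 0) lamt)
    (d : Fin r → Equiv.Perm (Fin n)) (hd : ∀ i, Is1A mu lam (A i) (d i))
    (dt : Fin r → Equiv.Perm (Fin (∑ s ∈ Finset.Ico (l-1) m, mu s)))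
    (hdt : ∀ i, Is1A (fun s => if s < m - (l-1) then mu (s + (l-1)) else 0) lamt
      (fun s => if s < m - (l-1) then A i (s + (l-1)) else 0) (dt i))
    (wmu : Equiv.Perm (Fin n)) (hwmu : IsWmu mu wmu)
    (wmut : Equiv.Perm (Fin (∑ s ∈ Finset.Ico (l-1) m, mu s)))
    (hwmut : IsWmu (fun s => if s < m - (l-1) then mu (s + (l-1)) else 0) wmut)
    -- homomorphism data over `H_{ñ}`
    (Mt : Submodule H'ᵐᵒᵖ H')
    (hMt : Mt = Submodule.span H'ᵐᵒᵖ
      {xElt T' (fun s => if s < m - (l-1) then mu (s + (l-1)) else 0)})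
    (St : Submodule H'ᵐᵒᵖ H')
    (hSt : St = Submodule.span H'ᵐᵒᵖ
      {xElt T' (fun s => if s < m - (l-1) then mu (s + (l-1)) else 0) *
        (T' wmut * yElt q T'
          (conjP (fun s => if s < m - (l-1) then mu (s + (l-1)) else 0)))})
    (hlet : St ≤ Mt)
    (hxt : xElt T' (fun s => if s < m - (l-1) then mu (s + (l-1)) else 0) ∈ Mt)
    (ψ : Fin r → (Mt →ₗ[H'ᵐᵒᵖ] H'))
    (hψ : ∀ i, ψ i ⟨xElt T' (fun s => if s < m - (l-1) then mu (s + (l-1)) else 0), hxt⟩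
      = XPhi T' lamt (fun s => if s < m - (l-1) then mu (s + (l-1)) else 0) (dt i))
    (hyp : ∀ (z : H') (hz : z ∈ St), ∑ i, c i • ψ i ⟨z, hlet hz⟩ = 0)
    -- homomorphism data over `H_n`
    (Mmu : Submodule Hᵐᵒᵖ H) (hMmu : Mmu = Submodule.span Hᵐᵒᵖ {xElt T mu})
    (Smu : Submodule Hᵐᵒᵖ H)
    (hSmu : Smu = Submodule.span Hᵐᵒᵖ {xElt T mu * (T wmu * yElt q T (conjP mu))})
    (hle : Smu ≤ Mmu) (hx : xElt T mu ∈ Mmu)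
    (φ : Fin r → (Mmu →ₗ[Hᵐᵒᵖ] H))
    (hφ : ∀ i, φ i ⟨xElt T mu, hx⟩ = XPhi T lam mu (d i)) :
    ∀ (z : H) (hz : z ∈ Smu), ∑ i, c i • φ i ⟨z, hle hz⟩ = 0 := by
  rcases r with _ | r
  · simp
  have hbm : l - 1 ≤ m := by omega
  have hN : cumSum mu (l - 1) + ∑ s ∈ Finset.Ico (l - 1) m, mu s ≤ n := by
    rw [cumSum_add_sum_Ico mu hbm]; exact hmu.1.cumSum_le m
  obtain ⟨ι, hι, hιmul⟩ := exists_windowMap hN hT hT'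
  obtain ⟨x, hx'⟩ := exists_mul_yElt_eq hT hT' hq hmu hbm hN ι hι hwmu
    (show IsWmu (rowWindow mu (l - 1) m) wmut from hwmut)
  have hlamt' : ∀ p < ∑ s ∈ Finset.Ico (l - 1) m, mu s, ∃ r, p < cumSum lamt (r + 1) := by
    refine exists_lt_cumSum_of_hasType (k := m - (l - 1)) (A := rowWindow (A 0) (l - 1) m)
      (nu := rowWindow mu (l - 1) m) (fun s => ?_) (fun s hs => rowWindow_of_le _ hs) ?_ (hlamt 0)
    · unfold rowWindow
      split_ifs
      · exact hshape 0 _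
      · rfl
    · have h1 := cumSum_rowWindow (b := l - 1) (m := m) mu le_rfl
      have h2 := cumSum_add_sum_Ico mu hbm
      rw [Nat.sub_add_cancel hbm] at h1
      omega
  have hword : ∀ i j, rowOf lam ((d i)⁻¹ (winEmb hN j) : Fin n) =
      rowOf lamt ((dt i)⁻¹ j : Fin _) := by
    intro i j
    have hw := rowOf_window hmu hbm j
    rw [(hd i).rowOf_inv,
      Is1A.rowOf_inv (mu := rowWindow mu (l - 1) m) (A := rowWindow (A i) (l - 1) m) (hdt i),
      winEmb_val, hw.2.1, hw.2.2]
    unfold entryAt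
    rw [rowWindow_of_lt _ hw.1]
  have hout : ∀ i, ∀ p ∉ Set.range (winEmb hN),
      rowOf lam ((d i)⁻¹ p : Fin n) = rowOf lam ((d 0)⁻¹ p : Fin n) := by
    intro i p hp
    rw [(hd i).rowOf_inv, (hd 0).rowOf_inv]
    unfold entryAt
    rw [houtside i 0 _ (rowOf_of_notMem_window hmu hbm hN hp)]
  obtain ⟨Y, hY⟩ : ∃ Y : H, ∀ i, XPhi T lam mu (d i) =
      Y * ι (XPhi T' lamt (rowWindow mu (l - 1) m) (dt i)) := by
    refine ⟨∑ e ∈ Finset.univ.filter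
      (· ∈ outerRowSet hN lam mu (fun p => rowOf lam ((d 0)⁻¹ p : Fin n))), T e, fun i => ?_⟩
    rw [XPhi_eq_mul hT hmu hbm hN ι hι hlam.exists_lt_cumSum hlamt' (hword i),
      outerRowSet_congr hN lam mu (hout i)]
  have hgen : ∑ i, c i • (XPhi T' lamt (rowWindow mu (l - 1) m) (dt i) *
      (T' wmut * yElt q T' (conjP (rowWindow mu (l - 1) m)))) = 0 := by
    rw [← hyp _ (hSt ▸ Submodule.mem_span_singleton_self _)]
    refine Finset.sum_congr rfl fun i _ => ?_
    rw [apply_mk_mul hxt, hψ i]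
    rfl
  intro z hz
  have hz' := hz
  rw [hSmu, Submodule.mem_span_singleton] at hz'
  obtain ⟨h, rfl⟩ := hz'
  have key : ∀ i, φ i ⟨_, hle hz⟩ = Y * ι (XPhi T' lamt (rowWindow mu (l - 1) m) (dt i) *
      (T' wmut * yElt q T' (conjP (rowWindow mu (l - 1) m)))) * (x * h.unop) := by
    intro i
    have e : h • (xElt T mu * (T wmu * yElt q T (conjP mu))) =
        xElt T mu * (T wmu * yElt q T (conjP mu) * h.unop) := mul_assoc _ _ _
    have e' : (⟨_, hle hz⟩ : Mmu) = ⟨_, e ▸ hle hz⟩ := Subtype.ext e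
    rw [e', apply_mk_mul hx, hφ, hY, hιmul, hx']
    simp only [mul_assoc]
  have key' : ∀ i, c i • φ i ⟨_, hle hz⟩ =
      Y * ι (c i • (XPhi T' lamt (rowWindow mu (l - 1) m) (dt i) *
        (T' wmut * yElt q T' (conjP (rowWindow mu (l - 1) m))))) * (x * h.unop) := by
    intro i
    rw [key i, map_smul, mul_smul_comm, smul_mul_assoc]
  rw [Finset.sum_congr rfl fun i _ => key' i, ← Finset.sum_mul, ← Finset.mul_sum, ← map_sum,
    hgen, map_zero, mul_zero, zero_mul]

end FayersSemistd
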